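/- If f ∈ Homeo_{0,λ}(T²) has a rotation set that is stable in Homeo_{0,λ}(T²), then for any lift f̃ of f the rotation set ρ(f̃) is the convex hull of a finite subset of ℚ² and has nonempty interior in ℝ². -/

import Mathlib

noncomputable section

open Metric Set Filter Topology MeasureTheory Pointwise

/-- The plane `ℝ²` with the Euclidean metric. -/
abbrev R2 : Type := EuclideanSpace ℝ (Fin 2)

/-- The integer lattice `ℤ² ⊂ ℝ²`. -/
def intLattice : AddSubgroup R2 where
  carrier := {v : R2 | ∀ i, ∃ n : ℤ, v i = (n : ℝ)}
  add_mem' := by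
    intro a b ha hb i
    obtain ⟨m, hm⟩ := ha i
    obtain ⟨n, hn⟩ := hb i
    exact ⟨m + n, by push_cast; rw [← hm, ← hn]; rfl⟩
  zero_mem' := fun i => ⟨0, by simp⟩
  neg_mem' := by
    intro a ha i
    obtain ⟨m, hm⟩ := ha i
    exact ⟨-m, by push_cast; rw [← hm]; rfl⟩

/-- The torus `T² = ℝ²/ℤ²`, with the quotient (Euclidean) metric. -/
abbrev T2 : Type := R2 ⧸ intLattice

/-- The covering projection `π : ℝ² → T²`. -/
def pr : R2 → T2 := QuotientAddGroup.mk

instance : MeasurableSpace T2 := borel T2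
instance : BorelSpace T2 := ⟨rfl⟩

/-- A fundamental domain `[0,1)²` for the lattice action. -/
def fundDomain : Set R2 := {x : R2 | ∀ i, x i ∈ Set.Ico (0 : ℝ) 1}

/-- Lebesgue (Haar) probability measure on the torus `T²`. -/
def lebT2 : Measure T2 := Measure.map pr (volume.restrict fundDomain)

/-- `F : ℝ² → ℝ²` is a lift of `f : T² → T²` if `π ∘ F = f ∘ π` and
`F (x + w) = F x + w` for every lattice vector `w ∈ ℤ²`. -/
structure IsLift (f : T2 ≃ₜ T2) (F : R2 ≃ₜ R2) : Prop where
  proj : ∀ x : R2, pr (F x) = f (pr x)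
  equivariant : ∀ x : R2, ∀ w ∈ intLattice, F (x + w) = F x + w

/-- `Homeo₀(T²)`: homeomorphisms of the torus isotopic to the identity,
characterized as those admitting a lift commuting with integer translations. -/
def Homeo0 : Set (T2 ≃ₜ T2) := {f | ∃ F : R2 ≃ₜ R2, IsLift f F}

/-- `Homeo_{0,λ}(T²)`: elements of `Homeo₀(T²)` preserving Lebesgue measure. -/
def Homeo0Leb : Set (T2 ≃ₜ T2) :=
  {f | f ∈ Homeo0 ∧ MeasurePreserving f lebT2 lebT2}

/-- The uniform `C⁰` distance `d_{C⁰}(f,g) = sup_x d(f(x), g(x))` on torus maps. -/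
def dC0 (f g : T2 ≃ₜ T2) : ℝ := ⨆ x : T2, dist (f x) (g x)

/-- The uniform distance `sup_{x ∈ ℝ²} ‖F(x) − G(x)‖` between maps of the plane. -/
def supDist (F G : R2 → R2) : ℝ := ⨆ x : R2, dist (F x) (G x)

/-- The rotation set `ρ(F̃)` of a lift: all limits `(F̃^{n_k}(z_k) − z_k)/n_k`. -/
def rotSet (F : R2 ≃ₜ R2) : Set R2 :=
  {v | ∃ (z : ℕ → R2) (n : ℕ → ℕ), Tendsto n atTop atTop ∧
    Tendsto (fun k => (n k : ℝ)⁻¹ • ((⇑F)^[n k] (z k) - z k)) atTop (𝓝 v)}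

/-- The rotation set of `f`, with fixed lift `F`, is `δ`-upper-stable in `H`. -/
def UpperStable (H : Set (T2 ≃ₜ T2)) (F : R2 ≃ₜ R2) (δ : ℝ) : Prop :=
  ∀ g ∈ H, ∀ G : R2 ≃ₜ R2, IsLift g G → supDist (⇑F) (⇑G) < δ →
    rotSet G ⊆ rotSet F

/-- The rotation set of `f`, with fixed lift `F`, is `δ`-stable in `H`. -/
def StableRS (H : Set (T2 ≃ₜ T2)) (F : R2 ≃ₜ R2) (δ : ℝ) : Prop :=
  ∀ g ∈ H, ∀ G : R2 ≃ₜ R2, IsLift g G → supDist (⇑F) (⇑G) < δ →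
    rotSet G = rotSet F

/-- `f` has a stable rotation set in `H`. -/
def HasStableRotSet (H : Set (T2 ≃ₜ T2)) (f : T2 ≃ₜ T2) : Prop :=
  ∃ F : R2 ≃ₜ R2, IsLift f F ∧ ∃ δ > 0, StableRS H F δ

/-- `S` is open in `H` for the uniform `C⁰` topology. -/
def OpenIn (H S : Set (T2 ≃ₜ T2)) : Prop :=
  ∀ f ∈ S ∩ H, ∃ δ > 0, ∀ g ∈ H, dC0 f g < δ → g ∈ S

/-- `S` is dense in `H` for the uniform `C⁰` topology. -/
def DenseIn (H S : Set (T2 ≃ₜ T2)) : Prop :=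
  ∀ f ∈ H, ∀ ε > 0, ∃ g ∈ S ∩ H, dC0 f g < ε

/-- `(x_i)_{0 ≤ i ≤ n}` is a finite `ε`-pseudo-orbit of `F`. -/
def IsPseudoOrbitUpTo (F : R2 → R2) (ε : ℝ) (x : ℕ → R2) (n : ℕ) : Prop :=
  ∀ i < n, dist (F (x i)) (x (i + 1)) < ε

/-- `(x_i)_{i ∈ ℕ}` is an infinite `ε`-pseudo-orbit of `F`. -/
def IsPseudoOrbit (F : R2 → R2) (ε : ℝ) (x : ℕ → R2) : Prop :=
  ∀ i : ℕ, dist (F (x i)) (x (i + 1)) < ε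

/-- The `ε`-pseudo-rotation set `ρ_ε(F̃)`. -/
def pseudoRotSet (F : R2 → R2) (ε : ℝ) : Set R2 :=
  {v | ∃ (n : ℕ → ℕ) (x : ℕ → ℕ → R2), Tendsto n atTop atTop ∧
    (∀ k, IsPseudoOrbitUpTo F ε (x k) (n k)) ∧
    Tendsto (fun k => (n k : ℝ)⁻¹ • (x k (n k) - x k 0)) atTop (𝓝 v)}

/-- The oscillation `osc(f) = sup_{x,y} ‖(F(x) − x) − (F(y) − y)‖` of a lift. -/
def osc (F : R2 → R2) : ℝ := ⨆ p : R2 × R2, ‖(F p.1 - p.1) - (F p.2 - p.2)‖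

/-- `f` has the shadowing property. -/
def Shadowing (f : T2 ≃ₜ T2) : Prop :=
  ∀ ε > 0, ∃ δ > 0, ∀ x : ℕ → T2, (∀ i, dist (f (x i)) (x (i + 1)) < δ) →
    ∃ z : T2, ∀ i, dist ((⇑f)^[i] z) (x i) < ε

/-- `v ∈ ℚ² ⊂ ℝ²`. -/
def IsRationalPoint (v : R2) : Prop := ∀ i, ∃ q : ℚ, v i = (q : ℝ)


/-! ### Torus basics -/

lemma pr_eq_iff (x y : R2) : pr x = pr y ↔ ∃ w ∈ intLattice, y = x + w := by
  unfold pr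
  rw [QuotientAddGroup.eq]
  constructor
  · intro h
    exact ⟨_, h, by abel⟩
  · rintro ⟨w, hw, rfl⟩
    simpa using hw

lemma pr_add (x w : R2) (hw : w ∈ intLattice) : pr (x + w) = pr x :=
  ((pr_eq_iff x (x + w)).2 ⟨w, hw, rfl⟩).symm

lemma continuous_pr : Continuous pr := continuous_quotient_mk'

lemma isOpenMap_pr : IsOpenMap pr := QuotientAddGroup.isOpenMap_coe

lemma surjective_pr : Function.Surjective pr := QuotientAddGroup.mk_surjective

/-- Integer vectors. -/
def zvec (m : Fin 2 → ℤ) : R2 := WithLp.toLp 2 (fun i => (m i : ℝ))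

lemma zvec_apply (m : Fin 2 → ℤ) (i : Fin 2) : zvec m i = (m i : ℝ) := rfl

lemma zvec_mem (m : Fin 2 → ℤ) : zvec m ∈ intLattice := fun i => ⟨m i, rfl⟩

lemma exists_zvec {w : R2} (hw : w ∈ intLattice) : ∃ m, w = zvec m := by
  choose m hm using hw
  exact ⟨m, by ext i; rw [hm i]; rfl⟩

instance : Countable intLattice := by
  have : Function.Surjective (fun m : Fin 2 → ℤ => (⟨zvec m, zvec_mem m⟩ : intLattice)) := by
    rintro ⟨w, hw⟩
    obtain ⟨m, rfl⟩ := exists_zvec hw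
    exact ⟨m, rfl⟩
  exact this.countable

lemma fund_existsUnique (x : R2) : ∃! g : intLattice, g +ᵥ x ∈ fundDomain := by
  refine ⟨⟨zvec (fun i => -⌊x i⌋), zvec_mem _⟩, ?_, ?_⟩
  · intro i
    have h1 := Int.floor_le (x i)
    have h2 := Int.lt_floor_add_one (x i)
    change zvec (fun i => -⌊x i⌋) i + x i ∈ _
    rw [zvec_apply]
    push_cast
    constructor <;> linarith
  · rintro ⟨w, hw⟩ h
    obtain ⟨m, rfl⟩ := exists_zvec hw
    have : m = fun i => -⌊x i⌋ := by
      funext i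
      have h1 : (m i : ℝ) + x i ∈ Set.Ico (0:ℝ) 1 := h i
      have : ⌊x i⌋ = - m i := by
        rw [Int.floor_eq_iff]
        push_cast
        constructor <;> linarith [h1.1, h1.2]
      omega
    subst this
    rfl

lemma measurableSet_fund : MeasurableSet fundDomain := by
  have : fundDomain = ⋂ i : Fin 2, (fun x : R2 => x i) ⁻¹' (Set.Ico (0:ℝ) 1) := by
    ext x; simp [fundDomain]
  rw [this]
  refine MeasurableSet.iInter fun i => ?_
  have hc : Continuous (fun x : R2 => x i) := by fun_prop
  exact hc.measurable measurableSet_Ico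

lemma isFund : IsAddFundamentalDomain intLattice fundDomain (volume : Measure R2) :=
  IsAddFundamentalDomain.mk' measurableSet_fund.nullMeasurableSet fund_existsUnique

lemma lebT2_apply {A : Set T2} (hA : MeasurableSet A) :
    lebT2 A = volume (pr ⁻¹' A ∩ fundDomain) := by
  unfold lebT2
  rw [Measure.map_apply continuous_pr.measurable hA,
    Measure.restrict_apply (continuous_pr.measurable hA)]

lemma pr_preimage_invariant (A : Set T2) (g : intLattice) :
    (fun x : R2 => g +ᵥ x) ⁻¹' (pr ⁻¹' A) = pr ⁻¹' A := by
  ext x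
  have : pr (g +ᵥ x) = pr x := by
    rw [← pr_add x g g.2, add_comm]; rfl
  simp [this]

lemma fund_subset_ball : fundDomain ⊆ Metric.closedBall (0 : R2) 2 := by
  intro x hx
  rw [mem_closedBall_zero_iff, EuclideanSpace.norm_eq]
  have h0 := hx 0
  have h1 := hx 1
  rw [Real.sqrt_le_left (by norm_num), Fin.sum_univ_two]
  simp only [Real.norm_eq_abs, sq_abs]
  nlinarith [h0.1, h0.2, h1.1, h1.2]

lemma lebT2_univ_ne_top : lebT2 Set.univ ≠ ⊤ := by
  rw [lebT2_apply MeasurableSet.univ]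
  simp only [Set.preimage_univ, Set.univ_inter]
  exact ((measure_mono fund_subset_ball).trans_lt measure_closedBall_lt_top).ne

lemma lebT2_open_null {U : Set T2} (hU : IsOpen U) (h : lebT2 U = 0) : U = ∅ := by
  rw [lebT2_apply hU.measurableSet] at h
  have h2 := isFund.measure_zero_of_invariant (pr ⁻¹' U) (fun g => by
    have := pr_preimage_invariant U (-g)
    rw [← Set.image_vadd, Set.image_eq_preimage_of_inverse (g := fun x : R2 => (-g) +ᵥ x)]
    · exact this
    · intro x; simp
    · intro x; simp) h
  have h3 := ((hU.preimage continuous_pr).measure_eq_zero_iff volume).1 h2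
  exact Set.preimage_eq_empty_iff.1 h3 |>.eq_bot_of_le (by
    rw [surjective_pr.range_eq]; exact Set.subset_univ _)

/-- Equivariance under integer translations. -/
def Equi (F : R2 → R2) : Prop := ∀ x : R2, ∀ w ∈ intLattice, F (x + w) = F x + w

lemma Equi.symm {H : R2 ≃ₜ R2} (h : Equi H) : Equi H.symm := by
  intro x w hw
  apply H.injective
  rw [h _ w hw]
  simp

/-- The torus map induced by an equivariant map. -/
def descFun (H : R2 → R2) (h : Equi H) : T2 → T2 :=
  Quotient.lift (fun x => pr (H x)) (by
    intro a b hab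
    have hab' : pr a = pr b := Quotient.sound hab
    obtain ⟨w, hw, rfl⟩ := (pr_eq_iff a b).1 hab'
    change pr (H a) = pr (H (a + w))
    rw [h _ w hw, pr_add _ _ hw])

lemma descFun_pr (H : R2 → R2) (h : Equi H) (x : R2) : descFun H h (pr x) = pr (H x) := rfl

lemma continuous_descFun (H : R2 → R2) (h : Equi H) (hc : Continuous H) :
    Continuous (descFun H h) :=
  (continuous_pr.comp hc).quotient_lift _

/-- The torus homeomorphism induced by an equivariant homeomorphism. -/
def desc (H : R2 ≃ₜ R2) (h : Equi H) : T2 ≃ₜ T2 where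
  toFun := descFun H h
  invFun := descFun H.symm h.symm
  left_inv := by
    intro t
    obtain ⟨x, rfl⟩ := surjective_pr t
    simp [descFun_pr]
  right_inv := by
    intro t
    obtain ⟨x, rfl⟩ := surjective_pr t
    simp [descFun_pr]
  continuous_toFun := continuous_descFun _ _ H.continuous
  continuous_invFun := continuous_descFun _ _ H.symm.continuous

lemma desc_isLift (H : R2 ≃ₜ R2) (h : Equi H) : IsLift (desc H h) H :=
  ⟨fun _ => rfl, h⟩

lemma desc_measurePreserving (H : R2 ≃ₜ R2) (h : Equi H)
    (hm : MeasurePreserving H volume volume) :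
    MeasurePreserving (desc H h) lebT2 lebT2 := by
  refine ⟨(desc H h).continuous.measurable, ?_⟩
  ext A hA
  rw [Measure.map_apply (desc H h).continuous.measurable hA,
    lebT2_apply ((desc H h).continuous.measurable hA), lebT2_apply hA]
  have hfd : IsAddFundamentalDomain intLattice (H '' fundDomain) (volume : Measure R2) := by
    refine IsAddFundamentalDomain.mk'
      ((H.measurableEmbedding.measurableSet_image).2 measurableSet_fund).nullMeasurableSet ?_
    intro x
    obtain ⟨g, hg, hu⟩ := fund_existsUnique (H.symm x)
    have key : ∀ g : intLattice, (g +ᵥ x ∈ H '' fundDomain ↔ g +ᵥ H.symm x ∈ fundDomain) := by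
      intro g
      have : H (g +ᵥ H.symm x) = g +ᵥ x := by
        have := h (H.symm x) g g.2
        rw [H.apply_symm_apply, add_comm, add_comm x] at this
        exact this
      rw [← this, H.injective.mem_set_image]
    refine ⟨g, (key g).2 hg, fun g' hg' => hu g' ((key g').1 hg')⟩
  have hA' : MeasurableSet (pr ⁻¹' A) := continuous_pr.measurable hA
  rw [isFund.measure_set_eq hfd hA' (pr_preimage_invariant A)]
  rw [← hm.measure_preimage (hA'.inter
    ((H.measurableEmbedding.measurableSet_image).2 measurableSet_fund)).nullMeasurableSet]
  congr 1
  rw [Set.preimage_inter, H.injective.preimage_image]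
  rfl

/-! ### Shears -/

/-- Elementary shear, as a map. -/
def shearFun (i j : Fin 2) (φ : ℝ → ℝ) (x : R2) : R2 :=
  x + φ (x j) • EuclideanSpace.single i (1:ℝ)

lemma shearFun_apply (i j : Fin 2) (φ : ℝ → ℝ) (x : R2) (k : Fin 2) :
    shearFun i j φ x k = x k + if k = i then φ (x j) else 0 := by
  simp [shearFun, Pi.single_apply]

/-- Elementary shear. -/
def shear (i j : Fin 2) (hij : j ≠ i) (φ : ℝ → ℝ) (hφ : Continuous φ) : R2 ≃ₜ R2 where
  toFun := shearFun i j φ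
  invFun := shearFun i j (fun t => - φ t)
  left_inv := by
    intro x; ext k
    simp only [shearFun_apply, if_neg hij]
    split_ifs <;> simp
  right_inv := by
    intro x; ext k
    simp only [shearFun_apply, if_neg hij]
    split_ifs <;> simp
  continuous_toFun := by unfold shearFun; fun_prop
  continuous_invFun := by unfold shearFun; fun_prop

lemma shear_coe (i j : Fin 2) (hij : j ≠ i) (φ : ℝ → ℝ) (hφ : Continuous φ) (x : R2) :
    shear i j hij φ hφ x = shearFun i j φ x := rfl

lemma shear_equi (i j : Fin 2) (hij : j ≠ i) (φ : ℝ → ℝ) (hφ : Continuous φ)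
    (hp : ∀ t : ℝ, ∀ n : ℤ, φ (t + n) = φ t) : Equi (shear i j hij φ hφ) := by
  intro x w hw
  obtain ⟨m, rfl⟩ := exists_zvec hw
  ext k
  simp only [shear_coe, shearFun_apply, PiLp.add_apply, zvec_apply, hp]
  ring

lemma shear_dist (i j : Fin 2) (hij : j ≠ i) (φ : ℝ → ℝ) (hφ : Continuous φ) {b : ℝ}
    (hb : ∀ t, |φ t| ≤ b) (x : R2) : dist (shear i j hij φ hφ x) x ≤ b := by
  rw [shear_coe, shearFun, dist_eq_norm, add_sub_cancel_left, norm_smul]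
  simpa using hb _

lemma shearProd_measurePreserving (φ : ℝ → ℝ) (hφ : Continuous φ) :
    MeasurePreserving (fun p : ℝ × ℝ => (p.1, p.2 + φ p.1)) volume volume := by
  refine (MeasurePreserving.id (volume : Measure ℝ)).skew_product
    (g := fun a b => b + φ a) ?_ ?_
  · exact Continuous.measurable (by fun_prop)
  · exact Filter.Eventually.of_forall fun a => map_add_right_eq_self volume _

lemma shear_measurePreserving (i j : Fin 2) (hij : j ≠ i) (φ : ℝ → ℝ) (hφ : Continuous φ) :
    MeasurePreserving (shear i j hij φ hφ) volume volume := by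
  have e1 : MeasurePreserving (MeasurableEquiv.toLp 2 (Fin 2 → ℝ)).symm volume volume :=
    EuclideanSpace.volume_preserving_symm_measurableEquiv_toLp (Fin 2)
  have e2 : MeasurePreserving (MeasurableEquiv.finTwoArrow (α := ℝ)) volume volume :=
    volume_preserving_finTwoArrow ℝ
  let e : R2 ≃ᵐ ℝ × ℝ := (MeasurableEquiv.toLp 2 (Fin 2 → ℝ)).symm.trans
    MeasurableEquiv.finTwoArrow
  have he : MeasurePreserving e volume volume := e2.comp e1
  have hs : MeasurePreserving (Prod.swap : ℝ × ℝ → ℝ × ℝ) volume volume :=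
    Measure.measurePreserving_swap
  have hP := shearProd_measurePreserving φ hφ
  have hea : ∀ x : R2, e x = (x 0, x 1) := fun x => rfl
  have main : ∀ K : ℝ × ℝ → ℝ × ℝ, MeasurePreserving K volume volume →
      (∀ x : R2, e (shear i j hij φ hφ x) = K (e x)) →
      MeasurePreserving (shear i j hij φ hφ) volume volume := by
    intro K hK hx
    have : (shear i j hij φ hφ : R2 → R2) = e.symm ∘ K ∘ e := by
      funext x
      simp only [Function.comp, ← hx, e.symm_apply_apply]
    rw [this]
    exact (he.symm e).comp (hK.comp he)
  fin_cases i <;> fin_cases j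
  · exact absurd rfl hij
  · refine main _ (hs.comp (hP.comp hs)) ?_
    intro x
    simp [hea, shear_coe, shearFun_apply]
  · refine main _ hP ?_
    intro x
    simp [hea, shear_coe, shearFun_apply]
  · exact absurd rfl hij

/-! ### Interpolation -/

/-- No two values agree modulo `1`. -/
def DistinctMod {n : ℕ} (a : Fin n → ℝ) : Prop := ∀ i j, i ≠ j → ∀ k : ℤ, a i - a j ≠ k

lemma exists_interp {n : ℕ} (a c : Fin n → ℝ) (ha : DistinctMod a) {b : ℝ} (hb0 : 0 ≤ b)
    (hb : ∀ i, |c i| ≤ b) :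
    ∃ φ : ℝ → ℝ, Continuous φ ∧ (∀ t : ℝ, ∀ k : ℤ, φ (t + k) = φ t) ∧ (∀ t, |φ t| ≤ b) ∧
      ∀ i, φ (a i) = c i := by
  let q : Fin n → UnitAddCircle := fun i => (a i : UnitAddCircle)
  have hq : Function.Injective q := by
    intro i j hij
    by_contra hne
    have h : ((a i - a j : ℝ) : UnitAddCircle) = 0 := by
      rw [AddCircle.coe_sub]; exact sub_eq_zero.2 hij
    obtain ⟨k, hk⟩ := (AddCircle.coe_eq_zero_iff (1:ℝ)).1 h
    exact ha i j hne k (by simpa using hk.symm)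
  let e := Equiv.ofInjective q hq
  haveI : DiscreteTopology (Set.range q) := (Set.finite_range q).instDiscreteTopology
  haveI : Finite (Set.range q) := (Set.finite_range q)
  let f0 : C(Set.range q, ℝ) := ⟨fun y => c (e.symm y), continuous_of_discreteTopology⟩
  let f : BoundedContinuousFunction (Set.range q) ℝ := BoundedContinuousFunction.mkOfCompact f0
  have hfn : ‖f‖ ≤ b := by
    rw [BoundedContinuousFunction.norm_le hb0]
    intro y
    exact hb _
  obtain ⟨g, hg, hgr⟩ := BoundedContinuousFunction.exists_norm_eq_domRestrict_eq_of_closed f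
    (Set.finite_range q).isClosed
  refine ⟨fun t => g (t : UnitAddCircle), ?_, ?_, ?_, ?_⟩
  · exact g.continuous.comp (AddCircle.continuous_mk' 1)
  · intro t k
    have : ((t + k : ℝ) : UnitAddCircle) = (t : UnitAddCircle) := by
      rw [AddCircle.coe_add]
      have : ((k : ℝ) : UnitAddCircle) = 0 :=
        (AddCircle.coe_eq_zero_iff (1:ℝ)).2 ⟨k, by simp⟩
      rw [this, add_zero]
    simp only [this]
  · intro t
    exact (g.norm_coe_le_norm _).trans (hg.le.trans hfn)
  · intro i
    have h1 : g (q i) = f ⟨q i, i, rfl⟩ := by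
      rw [← hgr]; rfl
    change g (q i) = c i
    rw [h1]
    change c (e.symm ⟨q i, i, rfl⟩) = c i
    congr 1
    exact e.symm_apply_apply i

/-! ### Realizing jumps -/

lemma abs_coord_le (x y : R2) (i : Fin 2) : |x i - y i| ≤ dist x y := by
  have := PiLp.norm_apply_le (x - y) i
  rw [dist_eq_norm]
  simpa using this

lemma realize {f : T2 ≃ₜ T2} (hf : f ∈ Homeo0Leb) {F : R2 ≃ₜ R2} (hF : IsLift f F) {ε : ℝ}
    {n : ℕ} (x z : Fin n → R2) (hε : 0 ≤ ε) (hd : ∀ i, dist (F (x i)) (z i) ≤ ε)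
    (h1 : DistinctMod (fun i => F (x i) 1)) (h2 : DistinctMod (fun i => z i 0)) :
    ∃ g ∈ Homeo0Leb, ∃ G : R2 ≃ₜ R2, IsLift g G ∧ supDist F G ≤ 2 * ε ∧ ∀ i, G (x i) = z i := by
  obtain ⟨φ, hφc, hφp, hφb, hφ⟩ := exists_interp _ (fun i => z i 0 - F (x i) 0) h1 hε
    (fun i => by
      rw [abs_sub_comm]; exact (abs_coord_le _ _ _).trans (hd i))
  obtain ⟨ψ, hψc, hψp, hψb, hψ⟩ := exists_interp _ (fun i => z i 1 - F (x i) 1) h2 hε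
    (fun i => by
      rw [abs_sub_comm]; exact (abs_coord_le _ _ _).trans (hd i))
  let s1 := shear 0 1 (by decide) φ hφc
  let s2 := shear 1 0 (by decide) ψ hψc
  have e1 : Equi s1 := shear_equi _ _ _ _ _ hφp
  have e2 : Equi s2 := shear_equi _ _ _ _ _ hψp
  have hlift : IsLift (f.trans ((desc s1 e1).trans (desc s2 e2))) (F.trans (s1.trans s2)) := by
    refine ⟨fun y => ?_, fun y w hw => ?_⟩
    · change pr (s2 (s1 (F y))) = desc s2 e2 (desc s1 e1 (f (pr y)))
      rw [← hF.proj y]; rfl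
    · change s2 (s1 (F (y + w))) = s2 (s1 (F y)) + w
      rw [hF.equivariant y w hw, e1 _ w hw, e2 _ w hw]
  refine ⟨_, ⟨⟨_, hlift⟩, ?_⟩, _, hlift, ?_, ?_⟩
  · have m1 := desc_measurePreserving s1 e1 (shear_measurePreserving _ _ _ _ _)
    have m2 := desc_measurePreserving s2 e2 (shear_measurePreserving _ _ _ _ _)
    exact (m2.comp m1).comp hf.2
  · refine ciSup_le fun y => ?_
    change dist (F y) (s2 (s1 (F y))) ≤ _
    have d1 : dist (s1 (F y)) (F y) ≤ ε := shear_dist _ _ _ _ _ hφb _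
    have d2 : dist (s2 (s1 (F y))) (s1 (F y)) ≤ ε := shear_dist _ _ _ _ _ hψb _
    have := dist_triangle (s2 (s1 (F y))) (s1 (F y)) (F y)
    rw [dist_comm]; linarith
  · intro i
    change s2 (s1 (F (x i))) = z i
    ext k
    simp only [s1, s2, shear_coe, shearFun_apply]
    have a := hφ i
    have b := hψ i
    simp only at a b
    fin_cases k
    · simp [a]
    · simp [a, b]

/-! ### Pseudo-orbits -/

/-- There is an `ε`-pseudo-orbit of length `n` from `x` to `y`. -/
def Reach (F : R2 → R2) (ε : ℝ) : ℕ → R2 → R2 → Prop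
  | 0, x, y => x = y
  | n + 1, x, y => ∃ z, Reach F ε n x z ∧ dist (F z) y < ε

lemma Reach.trans {F : R2 → R2} {ε : ℝ} {m n : ℕ} {x y z : R2} (h1 : Reach F ε m x y)
    (h2 : Reach F ε n y z) : Reach F ε (m + n) x z := by
  induction n generalizing z with
  | zero => cases h2; exact h1
  | succ n ih =>
    obtain ⟨u, hu, hd⟩ := h2
    exact ⟨u, ih hu, hd⟩

lemma Reach.translate {F : R2 → R2} (hF : Equi F) {ε : ℝ} {n : ℕ} {x y w : R2}
    (hw : w ∈ intLattice) (h : Reach F ε n x y) : Reach F ε n (x + w) (y + w) := by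
  induction n generalizing y with
  | zero => cases h; rfl
  | succ n ih =>
    obtain ⟨u, hu, hd⟩ := h
    exact ⟨u + w, ih hu, by rwa [hF u w hw, dist_add_right]⟩

lemma Reach.seq {F : R2 → R2} {ε : ℝ} {n : ℕ} {x y : R2} (h : Reach F ε n x y) :
    ∃ s : ℕ → R2, s 0 = x ∧ s n = y ∧ ∀ i < n, dist (F (s i)) (s (i + 1)) < ε := by
  induction n generalizing y with
  | zero => cases h; exact ⟨fun _ => x, rfl, rfl, by simp⟩
  | succ n ih =>
    obtain ⟨u, hu, hd⟩ := h
    obtain ⟨s, h0, hn, hs⟩ := ih hu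
    refine ⟨Function.update s (n + 1) y, ?_, ?_, ?_⟩
    · simp [Function.update, h0]
    · simp
    · intro i hi
      by_cases hin : i = n
      · subst hin
        rw [Function.update_self, Function.update_of_ne (by omega), hn]
        exact hd
      · rw [Function.update_of_ne (by omega), Function.update_of_ne (by omega)]
        exact hs i (by omega)

lemma Reach.of_seq {F : R2 → R2} {ε : ℝ} (s : ℕ → R2) {n : ℕ}
    (hs : ∀ i < n, dist (F (s i)) (s (i + 1)) < ε) : Reach F ε n (s 0) (s n) := by
  induction n with
  | zero => rfl
  | succ n ih => exact ⟨s n, ih (fun i hi => hs i (by omega)), hs n (by omega)⟩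

/-! ### The rotation set -/

lemma mem_rotSet_iff {F : R2 ≃ₜ R2} {v : R2} : v ∈ rotSet F ↔
    ∀ ε > 0, ∀ N : ℕ, ∃ n ≥ N, ∃ z, dist ((n : ℝ)⁻¹ • ((⇑F)^[n] z - z)) v < ε := by
  constructor
  · rintro ⟨z, n, hn, hv⟩ ε hε N
    have h1 := (Metric.tendsto_nhds.1 hv) ε hε
    have h2 := hn.eventually_ge_atTop N
    obtain ⟨k, hk1, hk2⟩ := (h1.and h2).exists
    exact ⟨n k, hk2, z k, hk1⟩
  · intro h
    choose n hn z hz using fun k : ℕ => h (1 / ((k : ℝ) + 1)) (by positivity) k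
    refine ⟨z, n, tendsto_atTop_mono hn tendsto_id, ?_⟩
    rw [tendsto_iff_dist_tendsto_zero]
    exact squeeze_zero (fun _ => dist_nonneg) (fun k => (hz k).le)
      tendsto_one_div_add_atTop_nhds_zero_nat

lemma isClosed_rotSet (F : R2 ≃ₜ R2) : IsClosed (rotSet F) := by
  rw [← closure_subset_iff_isClosed]
  intro v hv
  rw [mem_rotSet_iff]
  intro ε hε N
  obtain ⟨u, hu, hd⟩ := Metric.mem_closure_iff.1 hv (ε / 2) (by positivity)
  obtain ⟨n, hn, z, hz⟩ := mem_rotSet_iff.1 hu (ε / 2) (by positivity) N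
  refine ⟨n, hn, z, ?_⟩
  have := dist_triangle ((n : ℝ)⁻¹ • ((⇑F)^[n] z - z)) u v
  rw [dist_comm] at hd
  linarith

lemma nsmul_mem_lat {w : R2} (hw : w ∈ intLattice) (k : ℕ) : (k : ℝ) • w ∈ intLattice := by
  rw [Nat.cast_smul_eq_nsmul]
  exact intLattice.nsmul_mem hw k

lemma periodic_mem_rotSet {G : R2 ≃ₜ R2} (hG : Equi G) {n : ℕ} (hn : 1 ≤ n) {x w : R2}
    (hw : w ∈ intLattice) (h : (⇑G)^[n] x = x + w) : (n : ℝ)⁻¹ • w ∈ rotSet G := by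
  have hit : ∀ m : ℕ, ∀ y : R2, ∀ u ∈ intLattice, (⇑G)^[m] (y + u) = (⇑G)^[m] y + u := by
    intro m
    induction m with
    | zero => intros; rfl
    | succ m ih => intro y u hu; rw [Function.iterate_succ_apply, hG y u hu, ih _ u hu]; rfl
  have hk : ∀ k : ℕ, (⇑G)^[n * k] x = x + (k : ℝ) • w := by
    intro k
    induction k with
    | zero => simp
    | succ k ih =>
      rw [Nat.mul_succ, add_comm, Function.iterate_add_apply, ih, hit _ _ _ (nsmul_mem_lat hw k),
        h]
      push_cast
      module
  rw [mem_rotSet_iff]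
  intro ε hε N
  refine ⟨n * (N + 1), by nlinarith, x, ?_⟩
  rw [hk]
  have : ((n * (N + 1) : ℕ) : ℝ)⁻¹ • (x + ((N + 1 : ℕ) : ℝ) • w - x) = (n : ℝ)⁻¹ • w := by
    rw [add_sub_cancel_left, smul_smul]
    congr 1
    have : (n : ℝ) ≠ 0 := by positivity
    push_cast
    field_simp
  rw [this]
  simpa using hε

/-! ### Generic position -/

/-- Families whose `i`-th and `j`-th members differ modulo `1` in coordinate `c`. -/
def genSet {n : ℕ} (c : Fin 2) (i j : Fin n) : Set (Fin n → R2) :=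
  {x | ∀ k : ℤ, x i c - x j c ≠ k}

lemma genSet_eq {n : ℕ} (c : Fin 2) (i j : Fin n) : genSet c i j =
    (fun x : Fin n → R2 => x i c - x j c) ⁻¹' (Set.range ((↑) : ℤ → ℝ))ᶜ := by
  ext x
  simp [genSet, eq_comm]

lemma genSet_isOpen {n : ℕ} (c : Fin 2) (i j : Fin n) : IsOpen (genSet c i j) := by
  rw [genSet_eq]
  refine IsOpen.preimage (by fun_prop) ?_
  exact Int.isClosedEmbedding_coe_real.isClosed_range.isOpen_compl

lemma genSet_dense {n : ℕ} (c : Fin 2) (i j : Fin n) (hij : i ≠ j) :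
    Dense (genSet c i j) := by
  rw [genSet_eq]
  refine Dense.preimage ((Set.countable_range _).dense_compl ℝ) ?_
  let T : (Fin n → R2) →L[ℝ] ℝ :=
    (EuclideanSpace.proj c : R2 →L[ℝ] ℝ).comp (ContinuousLinearMap.proj i) -
      (EuclideanSpace.proj c : R2 →L[ℝ] ℝ).comp (ContinuousLinearMap.proj j)
  have hT : Function.Surjective T := by
    intro t
    refine ⟨Function.update 0 i (EuclideanSpace.single c t), ?_⟩
    simp [T, Function.update_of_ne hij.symm]
  exact T.isOpenMap hT

lemma exists_generic {n : ℕ} (F : R2 ≃ₜ R2) (U : Set (Fin n → R2)) (hU : IsOpen U)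
    (hne : U.Nonempty) : ∃ x ∈ U, DistinctMod (fun i => F (x i) 1) ∧
      DistinctMod (fun i => x i 0) := by
  let Φ : (Fin n → R2) ≃ₜ (Fin n → R2) := Homeomorph.piCongrRight (fun _ => F)
  let ι := {p : Fin n × Fin n // p.1 ≠ p.2}
  have hd : Dense (⋂ p : ι, (genSet 0 p.1.1 p.1.2 ∩ Φ ⁻¹' genSet 1 p.1.1 p.1.2)) := by
    refine dense_iInter_of_isOpen (fun p => ?_) (fun p => ?_)
    · exact (genSet_isOpen _ _ _).inter ((genSet_isOpen _ _ _).preimage Φ.continuous)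
    · exact (genSet_dense _ _ _ p.2).inter_of_isOpen_left
        ((genSet_dense _ _ _ p.2).preimage Φ.isOpenMap) (genSet_isOpen _ _ _)
  obtain ⟨x, hxU, hx⟩ := hd.inter_open_nonempty U hU hne
  rw [Set.mem_iInter] at hx
  exact ⟨x, hxU, fun i j hij => (hx ⟨(i, j), hij⟩).2, fun i j hij => (hx ⟨(i, j), hij⟩).1⟩

/-- Closed pseudo-orbits are realized by the rotation set of a stable map. -/
lemma loop_mem_rotSet {f : T2 ≃ₜ T2} (hf : f ∈ Homeo0Leb) {F : R2 ≃ₜ R2} (hF : IsLift f F)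
    {δ ε : ℝ} (hst : StableRS Homeo0Leb F δ) (hε : 0 < ε) (hεδ : 2 * ε < δ)
    {n : ℕ} (hn : 1 ≤ n) {x w : R2} (hw : w ∈ intLattice) (h : Reach F ε n x (x + w)) :
    (n : ℝ)⁻¹ • w ∈ rotSet F := by
  obtain ⟨m, rfl⟩ : ∃ m, n = m + 1 := ⟨n - 1, by omega⟩
  obtain ⟨s, hs0, hsn, hs⟩ := h.seq
  let u : Fin (m + 1) → R2 := fun i => if i = Fin.last m then w else 0
  have hu : ∀ i, u i ∈ intLattice := by
    intro i
    simp only [u]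
    split_ifs
    · exact hw
    · exact intLattice.zero_mem
  let U : Set (Fin (m + 1) → R2) := {y | ∀ i, dist (F (y i)) (y (i + 1) + u i) < ε}
  have hU : IsOpen U := by
    have : U = ⋂ i, {y | dist (F (y i)) (y (i + 1) + u i) < ε} := by
      ext y; simp [U]
    rw [this]
    refine isOpen_iInter_of_finite fun i => ?_
    exact isOpen_lt (by fun_prop) continuous_const
  have hne : U.Nonempty := by
    refine ⟨fun i => s i, ?_⟩
    intro i
    have h1 := hs i i.2
    by_cases hi : i = Fin.last m
    · subst hi
      simp only [u, if_true, Fin.last_add_one]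
      simp only [Fin.val_last, Fin.val_zero] at h1 ⊢
      rw [hs0, ← hsn]; exact h1
    · simp only [u, if_neg hi, add_zero]
      rw [Fin.val_add_one_of_lt (Fin.lt_last_iff_ne_last.2 hi)]
      exact h1
  obtain ⟨y, hyU, hy1, hy2⟩ := exists_generic F U hU hne
  have hz : DistinctMod (fun i => (y (i + 1) + u i) 0) := by
    intro i j hij k hk
    obtain ⟨a, ha⟩ := hu i 0
    obtain ⟨b, hb⟩ := hu j 0
    refine hy2 (i + 1) (j + 1) (fun h => hij (add_right_cancel h)) (k - a + b) ?_
    simp only [PiLp.add_apply] at hk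
    rw [ha, hb] at hk
    push_cast
    linarith
  obtain ⟨g, hg, G, hG, hd, hGy⟩ := realize hf hF y (fun i => y (i + 1) + u i) hε.le
    (fun i => (hyU i).le) hy1 hz
  rw [← hst g hg G hG (hd.trans_lt hεδ)]
  have hit : ∀ k : ℕ, ∀ hk : k < m + 1, (⇑G)^[k] (y 0) = y ⟨k, hk⟩ := by
    intro k
    induction k with
    | zero => intro _; rfl
    | succ k ih =>
      intro hk
      have hne : (⟨k, by omega⟩ : Fin (m + 1)) ≠ Fin.last m := by
        intro h
        have := congrArg Fin.val h
        simp at this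
        omega
      rw [Function.iterate_succ_apply', ih (by omega), hGy]
      simp only [u, if_neg hne, add_zero]
      congr 1
      ext
      rw [Fin.val_add_one_of_lt (Fin.lt_last_iff_ne_last.2 hne)]
  refine periodic_mem_rotSet hG.equivariant hn hw (x := y 0) ?_
  rw [Function.iterate_succ_apply', hit m (by omega)]
  have := hGy (Fin.last m)
  simp only [u, if_true, Fin.last_add_one] at this
  exact this

/-! ### Chain transitivity -/

lemma chain_transitive {f : T2 ≃ₜ T2} (hf : f ∈ Homeo0Leb) {F : R2 ≃ₜ R2} (hF : IsLift f F)
    {ε : ℝ} (hε : 0 < ε) (x y : R2) :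
    ∃ n, 1 ≤ n ∧ ∃ w ∈ intLattice, Reach F ε n x (y + w) := by
  let W : Set R2 := {y | ∃ n, 1 ≤ n ∧ ∃ w ∈ intLattice, Reach F ε n x (y + w)}
  have hWinv : ∀ y ∈ W, ∀ w ∈ intLattice, y + w ∈ W := by
    rintro y ⟨n, hn, u, hu, h⟩ w hw
    exact ⟨n, hn, u - w, intLattice.sub_mem hu hw, by
      rwa [show y + w + (u - w) = y + u by abel]⟩
  have hWopen : IsOpen W := by
    rw [isOpen_iff_mem_nhds]
    rintro y ⟨n, hn, u, hu, h⟩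
    obtain ⟨m, rfl⟩ : ∃ m, n = m + 1 := ⟨n - 1, by omega⟩
    obtain ⟨z, hz, hd⟩ := h
    have ho : IsOpen {y' : R2 | dist (F z) (y' + u) < ε} :=
      isOpen_lt (by fun_prop) continuous_const
    filter_upwards [ho.mem_nhds hd] with y' hy'
    exact ⟨m + 1, hn, u, hu, z, hz, hy'⟩
  have hWcl : ∀ y ∈ closure W, F y ∈ W := by
    intro y hy
    have ho : IsOpen {y' : R2 | dist (F y') (F y) < ε} :=
      isOpen_lt (by fun_prop) continuous_const
    obtain ⟨y', hy', n, hn, u, hu, h⟩ := mem_closure_iff.1 hy _ ho (by simpa using hε)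
    refine ⟨n + 1, by omega, u, hu, y' + u, h, ?_⟩
    rw [hF.equivariant _ u hu, dist_add_right]
    exact hy'
  have hpre : pr ⁻¹' (pr '' W) = W := by
    refine Set.Subset.antisymm ?_ (Set.subset_preimage_image _ _)
    rintro y ⟨y', hy', he⟩
    obtain ⟨w, hw, rfl⟩ := (pr_eq_iff y' y).1 he
    exact hWinv _ hy' w hw
  set U : Set T2 := pr '' W with hUdef
  have hUopen : IsOpen U := isOpenMap_pr _ hWopen
  have hclU : pr ⁻¹' (closure U) = closure W := by
    rw [isOpenMap_pr.preimage_closure_eq_closure_preimage continuous_pr, hpre]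
  have hfU : f '' closure U ⊆ U := by
    rintro _ ⟨t, ht, rfl⟩
    obtain ⟨y, rfl⟩ := surjective_pr t
    have hy : y ∈ closure W := by rw [← hclU]; exact ht
    rw [← hF.proj y]
    exact ⟨_, hWcl y hy, rfl⟩
  have hfcl : IsClosed (f '' closure U) := f.isClosedMap _ isClosed_closure
  have hmeas : lebT2 (f '' U) = lebT2 U := by
    have h1 : MeasurableSet (f '' U) := (f.isOpenMap _ hUopen).measurableSet
    rw [← hf.2.measure_preimage h1.nullMeasurableSet, f.injective.preimage_image]
  have hnull : lebT2 (U \ f '' closure U) = 0 := by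
    have hle : lebT2 U ≤ lebT2 (f '' closure U) := by
      rw [← hmeas]; exact measure_mono (Set.image_mono subset_closure)
    have hfin : lebT2 (f '' closure U) ≠ ⊤ :=
      ((measure_mono (Set.subset_univ _)).trans_lt (lt_top_iff_ne_top.2 lebT2_univ_ne_top)).ne
    rw [measure_sdiff hfU hfcl.measurableSet.nullMeasurableSet hfin]
    exact tsub_eq_zero_of_le hle
  have hemp := lebT2_open_null (hUopen.sdiff hfcl) hnull
  have hUeq : U = f '' closure U :=
    Set.Subset.antisymm (Set.sdiff_eq_empty.1 hemp) hfU
  have hUclosed : IsClosed U := by rw [hUeq]; exact hfcl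
  have hWclosed : IsClosed W := by rw [← hpre]; exact hUclosed.preimage continuous_pr
  have hWne : W.Nonempty :=
    ⟨F x, 1, le_rfl, 0, intLattice.zero_mem, x, rfl, by simpa using hε⟩
  have : W = Set.univ := IsClopen.eq_univ ⟨hWclosed, hWopen⟩ hWne
  have : y ∈ W := by rw [this]; trivial
  exact this

/-! ### Returns to the origin -/

/-- There is a closed pseudo-orbit based at `0` of length `n` and displacement `w`. -/
def Ret (F : R2 → R2) (ε : ℝ) (n : ℕ) (w : R2) : Prop :=
  1 ≤ n ∧ w ∈ intLattice ∧ Reach F ε n 0 w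

lemma Ret.add {F : R2 → R2} (hF : Equi F) {ε : ℝ} {n m : ℕ} {w u : R2} (h1 : Ret F ε n w)
    (h2 : Ret F ε m u) : Ret F ε (n + m) (w + u) := by
  refine ⟨by have := h1.1; omega, intLattice.add_mem h1.2.1 h2.2.1, h1.2.2.trans ?_⟩
  have := h2.2.2.translate hF h1.2.1
  rwa [zero_add, add_comm] at this

lemma Ret.nsmul {F : R2 → R2} (hF : Equi F) {ε : ℝ} {n : ℕ} {w : R2} (h : Ret F ε n w)
    (k : ℕ) : Ret F ε ((k + 1) * n) (((k + 1 : ℕ) : ℝ) • w) := by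
  induction k with
  | zero => simpa using h
  | succ k ih =>
    have := ih.add hF h
    convert this using 1
    · ring
    · push_cast; module

/-- Rotation vectors of returns. -/
def retVecs (F : R2 → R2) (ε : ℝ) : Set R2 := {v | ∃ n w, Ret F ε n w ∧ v = (n : ℝ)⁻¹ • w}

lemma tendsto_floor_succ {a : ℝ} (ha : 0 ≤ a) :
    Tendsto (fun k : ℕ => ((⌊a * k⌋₊ + 1 : ℕ) : ℝ) / k) atTop (𝓝 a) := by
  have h1 := (tendsto_nat_floor_mul_div_atTop ha).comp (tendsto_natCast_atTop_atTop (R := ℝ))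
  have h2 := tendsto_one_div_atTop_nhds_zero_nat (𝕜 := ℝ)
  have := h1.add h2
  rw [add_zero] at this
  refine this.congr fun k => ?_
  simp only [Function.comp]
  push_cast
  ring

lemma convex_closure_retVecs {F : R2 → R2} (hF : Equi F) {ε : ℝ} :
    Convex ℝ (closure (retVecs F ε)) := by
  intro p hp q hq a b ha hb hab
  refine map_mem_closure₂ (f := fun p q : R2 => a • p + b • q) (by fun_prop) hp hq
    (s := retVecs F ε) (t := retVecs F ε) (u := closure (retVecs F ε)) ?_ |> fun h => by
      rwa [closure_closure] at h
  rintro _ ⟨n, w, hnw, rfl⟩ _ ⟨m, u, hmu, rfl⟩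
  have hn : (n : ℝ) ≠ 0 := by have := hnw.1; positivity
  have hm : (m : ℝ) ≠ 0 := by have := hmu.1; positivity
  obtain ⟨n', hn'⟩ : ∃ n', n = n' + 1 := ⟨n - 1, by have := hnw.1; omega⟩
  obtain ⟨m', hm'⟩ : ∃ m', m = m' + 1 := ⟨m - 1, by have := hmu.1; omega⟩
  let A : ℕ → ℝ := fun k => ((⌊a * k⌋₊ + 1 : ℕ) : ℝ)
  let B : ℕ → ℝ := fun k => ((⌊b * k⌋₊ + 1 : ℕ) : ℝ)
  have hA : ∀ k, 0 < A k := fun k => by simp only [A]; positivity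
  have hB : ∀ k, 0 < B k := fun k => by simp only [B]; positivity
  have tA : Tendsto (fun k : ℕ => A k / k) atTop (𝓝 a) := tendsto_floor_succ ha
  have tB : Tendsto (fun k : ℕ => B k / k) atTop (𝓝 b) := tendsto_floor_succ hb
  have tS : Tendsto (fun k : ℕ => A k / k + B k / k) atTop (𝓝 1) := by
    have := tA.add tB; rwa [hab] at this
  have t1 : Tendsto (fun k : ℕ => A k / (A k + B k)) atTop (𝓝 a) := by
    have := tA.div tS one_ne_zero
    rw [div_one] at this
    refine this.congr' ?_
    filter_upwards [eventually_gt_atTop 0] with k hk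
    have : (k : ℝ) ≠ 0 := by positivity
    have := hA k; have := hB k
    simp only [Pi.div_apply]
    field_simp
  have t2 : Tendsto (fun k : ℕ => B k / (A k + B k)) atTop (𝓝 b) := by
    have := tB.div tS one_ne_zero
    rw [div_one] at this
    refine this.congr' ?_
    filter_upwards [eventually_gt_atTop 0] with k hk
    have : (k : ℝ) ≠ 0 := by positivity
    have := hA k; have := hB k
    simp only [Pi.div_apply]
    field_simp
  have t3 := (t1.smul_const ((n : ℝ)⁻¹ • w)).add (t2.smul_const ((m : ℝ)⁻¹ • u))
  refine mem_closure_of_tendsto t3 (Eventually.of_forall fun k => ?_)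
  have r1 := (hnw.nsmul hF m').nsmul hF ⌊a * k⌋₊
  have r2 := (hmu.nsmul hF n').nsmul hF ⌊b * k⌋₊
  refine ⟨_, _, r1.add hF r2, ?_⟩
  rw [← hn', ← hm']
  have := hA k; have := hB k
  have hAB : A k + B k ≠ 0 := by positivity
  have e : ((((⌊a * k⌋₊ + 1) * (m * n) + (⌊b * k⌋₊ + 1) * (n * m) : ℕ)) : ℝ)
      = (A k + B k) * (n * m) := by
    simp only [A, B]; push_cast; ring
  rw [e]
  change _ = _ • (A k • (m : ℝ) • w + B k • (n : ℝ) • u)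
  rw [smul_add]
  simp only [smul_smul]
  congr 2 <;> field_simp

/-- Loops at any base point. -/
lemma loop_mem_closure {f : T2 ≃ₜ T2} (hf : f ∈ Homeo0Leb) {F : R2 ≃ₜ R2} (hF : IsLift f F)
    {ε : ℝ} (hε : 0 < ε) {n : ℕ} (hn : 1 ≤ n) {x w : R2} (hw : w ∈ intLattice)
    (h : Reach F ε n x (x + w)) : (n : ℝ)⁻¹ • w ∈ closure (retVecs F ε) := by
  have hE : Equi F := hF.equivariant
  obtain ⟨c, hc, s, hs, h1⟩ := chain_transitive hf hF hε 0 x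
  obtain ⟨d, hd, r, hr, h2⟩ := chain_transitive hf hF hε x 0
  rw [zero_add] at h2
  have hloop : ∀ j : ℕ, Reach F ε (j * n) x (x + (j : ℝ) • w) := by
    intro j
    induction j with
    | zero => simp [Reach]
    | succ j ih =>
      have := ih.trans (h.translate hE (nsmul_mem_lat hw j))
      convert this using 1
      · ring
      · push_cast; module
  have hret : ∀ j : ℕ, Ret F ε (c + (j * n + d)) (r + s + (j : ℝ) • w) := by
    intro j
    refine ⟨by omega, intLattice.add_mem (intLattice.add_mem hr hs) (nsmul_mem_lat hw j), ?_⟩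
    refine h1.trans ?_
    have := ((hloop j).trans (h2.translate hE (nsmul_mem_lat hw j))).translate hE hs
    convert this using 1
    abel
  have hn0 : (n : ℝ) ≠ 0 := by positivity
  have t0 := tendsto_one_div_atTop_nhds_zero_nat (𝕜 := ℝ)
  have t1 : Tendsto (fun j : ℕ => ((c + d : ℝ) * (1 / j) + n)⁻¹ •
      ((1 / (j:ℝ)) • (r + s) + w)) atTop (𝓝 ((n : ℝ)⁻¹ • w)) := by
    have a1 := ((t0.const_mul (c + d : ℝ)).add_const (n : ℝ)).inv₀ (by simpa using hn0)
    have a2 := (t0.smul_const (r + s)).add_const w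
    have := a1.smul a2
    simpa using this
  refine mem_closure_of_tendsto t1 ?_
  filter_upwards [eventually_gt_atTop 0] with j hj
  refine ⟨_, _, hret j, ?_⟩
  have hj0 : (j : ℝ) ≠ 0 := by positivity
  have e1 : ((1 / (j:ℝ)) • (r + s) + w) = (1 / (j:ℝ)) • (r + s + (j : ℝ) • w) := by
    rw [smul_add _ (r + s), smul_smul, one_div_mul_cancel hj0, one_smul]
  rw [e1, smul_smul]
  congr 1
  push_cast
  rw [one_div, ← mul_inv]
  congr 1
  field_simp
  ring

/-! ### Nondegeneracy -/

lemma exists_not_affine {f : T2 ≃ₜ T2} (hf : f ∈ Homeo0Leb) {F : R2 ≃ₜ R2} (hF : IsLift f F)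
    {ε : ℝ} (hε : 0 < ε) (l : R2 →ₗ[ℝ] ℝ) (c : ℝ)
    (h : ∀ n w, Ret F ε n w → l w = c * n) : l = 0 := by
  have hE : Equi F := hF.equivariant
  choose n hn w hw hr using fun y => chain_transitive hf hF hε 0 y
  let u : R2 → ℝ := fun y => l (w y) - c * n y
  have huniq : ∀ y m s, s ∈ intLattice → 1 ≤ m → Reach F ε m 0 (y + s) → l s - c * m = u y := by
    intro y m s hs hm hms
    obtain ⟨k, hk, r, hrr, h2⟩ := chain_transitive hf hF hε y 0
    rw [zero_add] at h2
    have a1 : Ret F ε (m + k) (r + s) :=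
      ⟨by omega, intLattice.add_mem hrr hs, hms.trans (h2.translate hE hs)⟩
    have a2 : Ret F ε (n y + k) (r + w y) :=
      ⟨by omega, intLattice.add_mem hrr (hw y), (hr y).trans (h2.translate hE (hw y))⟩
    have b1 := h _ _ a1
    have b2 := h _ _ a2
    rw [map_add] at b1 b2
    push_cast at b1 b2
    simp only [u]
    linarith
  have hloc : IsLocallyConstant u := by
    rw [IsLocallyConstant.iff_eventually_eq]
    intro y
    obtain ⟨m, hm⟩ : ∃ m, n y = m + 1 := ⟨n y - 1, by have := hn y; omega⟩
    have h3 := hr y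
    rw [hm] at h3
    obtain ⟨z, hz, hd⟩ := h3
    have ho : IsOpen {y' : R2 | dist (F z) (y' + w y) < ε} :=
      isOpen_lt (by fun_prop) continuous_const
    filter_upwards [ho.mem_nhds hd] with y' hy'
    have h4 : Reach F ε (n y) 0 (y' + w y) := by rw [hm]; exact ⟨z, hz, hy'⟩
    exact (huniq y' (n y) (w y) (hw y) (hn y) h4).symm
  have hconst : ∀ y y', u y = u y' := fun y y' => hloc.apply_eq_of_preconnectedSpace y y'
  have hlat : ∀ s ∈ intLattice, l s = 0 := by
    intro s hs
    have h5 := huniq s (n 0) (w 0 - s) (intLattice.sub_mem (hw 0) hs) (hn 0) (by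
      have := hr 0
      rwa [zero_add, ← add_sub_cancel s (w 0)] at this)
    rw [hconst s 0, map_sub] at h5
    simp only [u] at h5
    linarith
  ext x
  have hx : x = x 0 • zvec (Pi.single 0 1) + x 1 • zvec (Pi.single 1 1) := by
    ext i
    fin_cases i <;> simp [zvec_apply]
  rw [hx, map_add, map_smul, map_smul, hlat _ (zvec_mem _), hlat _ (zvec_mem _)]
  simp

lemma interior_nonempty_of {f : T2 ≃ₜ T2} (hf : f ∈ Homeo0Leb) {F : R2 ≃ₜ R2} (hF : IsLift f F)
    {ε : ℝ} (hε : 0 < ε) {K : Set R2} (hK : Convex ℝ K) (hsub : retVecs F ε ⊆ K) :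
    (interior K).Nonempty := by
  rw [hK.interior_nonempty_iff_affineSpan_eq_top]
  by_contra hne
  obtain ⟨n0, hn0, w0, hw0, h0⟩ := chain_transitive hf hF hε 0 0
  rw [zero_add] at h0
  have hp0 : (n0 : ℝ)⁻¹ • w0 ∈ K := hsub ⟨n0, w0, ⟨hn0, hw0, h0⟩, rfl⟩
  set p := (n0 : ℝ)⁻¹ • w0
  have hdir : (affineSpan ℝ K).direction < ⊤ := by
    rw [lt_top_iff_ne_top]
    intro h
    exact hne ((AffineSubspace.direction_eq_top_iff_of_nonempty
      ⟨p, subset_affineSpan ℝ K hp0⟩).1 h)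
  obtain ⟨l, hl, hker⟩ := Submodule.exists_le_ker_of_lt_top _ hdir
  refine hl (exists_not_affine hf hF hε l (l p) ?_)
  intro n w hnw
  have hq : (n : ℝ)⁻¹ • w ∈ K := hsub ⟨n, w, hnw, rfl⟩
  have h1 := hker (AffineSubspace.vsub_mem_direction (subset_affineSpan ℝ K hq)
    (subset_affineSpan ℝ K hp0))
  rw [LinearMap.mem_ker, vsub_eq_sub, map_sub, map_smul, smul_eq_mul] at h1
  have hn : (n : ℝ) ≠ 0 := by have := hnw.1; positivity
  field_simp at h1
  linarith

/-! ### Cells -/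

/-- The grid cell of a point. -/
def cell (N : ℕ) (x : R2) : Fin 2 → ℤ := fun i => ⌊(N : ℝ) * x i⌋

/-- The grid corner of a point. -/
def corner (N : ℕ) (x : R2) : R2 := (N : ℝ)⁻¹ • zvec (cell N x)

lemma cell_add (N : ℕ) (x : R2) (m : Fin 2 → ℤ) :
    cell N (x + zvec m) = fun i => cell N x i + N * m i := by
  funext i
  simp only [cell, PiLp.add_apply, zvec_apply, mul_add]
  rw [show (N : ℝ) * (m i : ℝ) = ((N * m i : ℤ) : ℝ) by push_cast; ring, Int.floor_add_intCast]

lemma cell_sub (N : ℕ) (x : R2) (m : Fin 2 → ℤ) :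
    cell N (x - zvec m) = fun i => cell N x i - N * m i := by
  have h := cell_add N (x - zvec m) m
  rw [sub_add_cancel] at h
  rw [h]
  funext i
  ring

lemma corner_sub {N : ℕ} (hN : 0 < N) (x : R2) (m : Fin 2 → ℤ) :
    corner N (x - zvec m) = corner N x - zvec m := by
  have hN' : (N : ℝ) ≠ 0 := by positivity
  ext i
  simp only [corner, cell_sub, PiLp.smul_apply, PiLp.sub_apply, zvec_apply, smul_eq_mul]
  push_cast
  field_simp

lemma norm_le_of_coord {x : R2} {b : ℝ} (h : ∀ i, |x i| ≤ b) : ‖x‖ ≤ 2 * b := by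
  have hb : 0 ≤ b := (abs_nonneg _).trans (h 0)
  rw [EuclideanSpace.norm_eq, Real.sqrt_le_left (by positivity), Fin.sum_univ_two]
  simp only [Real.norm_eq_abs]
  nlinarith [h 0, h 1, abs_nonneg (x 0), abs_nonneg (x 1)]

lemma corner_dist {N : ℕ} (hN : 0 < N) (x : R2) : ‖corner N x - x‖ ≤ 2 * (N : ℝ)⁻¹ := by
  have hN' : (0 : ℝ) < N := by positivity
  refine norm_le_of_coord fun i => ?_
  have h1 := Int.floor_le ((N : ℝ) * x i)
  have h2 := Int.lt_floor_add_one ((N : ℝ) * x i)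
  simp only [corner, PiLp.smul_apply, PiLp.sub_apply, zvec_apply, smul_eq_mul, cell]
  have : (N : ℝ)⁻¹ * (⌊(N : ℝ) * x i⌋ : ℝ) - x i =
      (N : ℝ)⁻¹ * ((⌊(N : ℝ) * x i⌋ : ℝ) - N * x i) := by field_simp
  rw [this, abs_mul, abs_of_pos (by positivity)]
  have h3 : |(⌊(N : ℝ) * x i⌋ : ℝ) - N * x i| ≤ 1 := by
    rw [abs_le]; constructor <;> linarith
  calc (N : ℝ)⁻¹ * |(⌊(N : ℝ) * x i⌋ : ℝ) - N * x i| ≤ (N : ℝ)⁻¹ * 1 := by gcongr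
    _ = _ := mul_one _

lemma dist_of_cell {N : ℕ} (hN : 0 < N) {x y : R2} (h : cell N x = cell N y) :
    dist x y ≤ 4 * (N : ℝ)⁻¹ := by
  have hc : corner N x = corner N y := by simp only [corner, h]
  have h1 := corner_dist hN x
  have h2 := corner_dist hN y
  rw [hc] at h1
  rw [← dist_eq_norm] at h1 h2
  have := dist_triangle_left x y (corner N y)
  linarith

lemma exists_repeat {N : ℕ} (hN : 0 < N) (s : ℕ → R2) : ∃ i j, i < j ∧ j ≤ N * N ∧
    ∃ m : Fin 2 → ℤ, cell N (s j) = fun l => cell N (s i) l + N * m l := by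
  haveI : NeZero N := ⟨hN.ne'⟩
  let c : Fin (N * N + 1) → ZMod N × ZMod N := fun i =>
    ((cell N (s i) 0 : ℤ), (cell N (s i) 1 : ℤ))
  obtain ⟨a, b, hab, hc⟩ := Fintype.exists_ne_map_eq_of_card_lt c (by
    simp [Fintype.card_prod, ZMod.card])
  have key : ∀ a b : Fin (N * N + 1), c a = c b → ∃ m : Fin 2 → ℤ,
      cell N (s b) = fun l => cell N (s a) l + N * m l := by
    intro a b h
    have h0 := (ZMod.intCast_eq_intCast_iff_dvd_sub _ _ N).1 (congrArg Prod.fst h)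
    have h1 := (ZMod.intCast_eq_intCast_iff_dvd_sub _ _ N).1 (congrArg Prod.snd h)
    obtain ⟨m0, hm0⟩ := h0
    obtain ⟨m1, hm1⟩ := h1
    refine ⟨![m0, m1], ?_⟩
    funext l
    fin_cases l
    · simp; linarith
    · simp; linarith
  rcases lt_or_gt_of_ne hab with h | h
  · exact ⟨a, b, h, by omega, key a b hc⟩
  · exact ⟨b, a, h, by omega, key b a hc.symm⟩

/-- One excision step. -/
lemma excise {F : R2 → R2} (hF : Equi F) {N : ℕ} (hN : 0 < N) {ε : ℝ}
    (hNε : 4 * (N : ℝ)⁻¹ < ε) {n : ℕ} (hn : N * N ≤ n) (s : ℕ → R2)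
    (hs : ∀ i < n, cell N (F (s i)) = cell N (s (i + 1))) :
    ∃ k, 1 ≤ k ∧ k ≤ N * N ∧ ∃ w ∈ intLattice, (∃ x, Reach F ε k x (x + w)) ∧
      ∃ y : ℕ → R2, (∀ i < n - k, cell N (F (y i)) = cell N (y (i + 1))) ∧
        corner N (s n) - corner N (s 0) = w + (corner N (y (n - k)) - corner N (y 0)) := by
  obtain ⟨i, j, hij, hj, m, hm⟩ := exists_repeat hN s
  have hw := zvec_mem m
  have hcj : cell N (s j - zvec m) = cell N (s i) := by
    rw [cell_sub, hm]; funext l; ring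
  have hFs : ∀ x, F (x - zvec m) = F x - zvec m := by
    intro x
    have := hF (x - zvec m) _ hw
    rw [sub_add_cancel] at this
    rw [this]; abel
  refine ⟨j - i, by omega, by omega, zvec m, hw, ⟨s i, ?_⟩, ?_⟩
  · let t : ℕ → R2 := fun l => if l < j - i then s (i + l) else s i + zvec m
    have h := Reach.of_seq (F := F) (ε := ε) t (n := j - i) (fun l hl => by
      refine (dist_of_cell hN ?_).trans_lt hNε
      simp only [t, if_pos hl]
      rw [hs _ (by omega)]
      split_ifs with h
      · rfl
      · rw [show i + l + 1 = j by omega, hm, cell_add])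
    have h0 : t 0 = s i := by simp only [t]; rw [if_pos (by omega)]; simp
    have h1 : t (j - i) = s i + zvec m := by simp [t]
    rwa [h0, h1] at h
  · refine ⟨fun l => if l < i then s l else s (l + (j - i)) - zvec m, ?_, ?_⟩
    · intro l hl
      by_cases h1 : l + 1 < i
      · simp only [if_pos h1, if_pos (show l < i by omega)]
        exact hs l (by omega)
      · by_cases h2 : l < i
        · simp only [if_neg h1, if_pos h2]
          rw [show l + 1 + (j - i) = j by omega, hcj, hs l (by omega),
            show l + 1 = i by omega]
        · simp only [if_neg h1, if_neg h2]
          rw [hFs, cell_sub, hs _ (by omega), cell_sub,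
            show l + (j - i) + 1 = l + 1 + (j - i) by omega]
    · have hy0 : corner N (if 0 < i then s 0 else s (0 + (j - i)) - zvec m)
          = corner N (s 0) := by
        split_ifs with h
        · rfl
        · have hi : i = 0 := by omega
          subst hi
          simp only [corner]
          rw [show 0 + (j - 0) = j by omega, hcj]
      simp only
      rw [hy0, if_neg (by omega), show n - (j - i) + (j - i) = n by omega, corner_sub hN]
      abel

/-! ### Displacement bounds -/

lemma exists_disp_bound {F : R2 → R2} (hF : Equi F) (hc : Continuous F) :
    ∃ C, 0 ≤ C ∧ ∀ x, dist x (F x) ≤ C := by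
  obtain ⟨C, hC⟩ := (isCompact_closedBall (0 : R2) 2).exists_bound_of_continuousOn
    (f := fun x => x - F x) (by fun_prop)
  refine ⟨max C 0, le_max_right _ _, fun x => ?_⟩
  obtain ⟨g, hg, -⟩ := fund_existsUnique x
  have h1 := hC _ (fund_subset_ball hg)
  have h2 : (g +ᵥ x : R2) = x + g := add_comm _ _
  simp only [h2, hF x g g.2, add_sub_add_right_eq_sub] at h1
  rw [dist_eq_norm]
  exact h1.trans (le_max_left _ _)

lemma Reach.dist_le {F : R2 → R2} {ε C : ℝ} (hC : ∀ x, dist x (F x) ≤ C) {n : ℕ} {x y : R2}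
    (h : Reach F ε n x y) : dist x y ≤ n * (C + ε) := by
  induction n generalizing y with
  | zero => cases h; simp
  | succ n ih =>
    obtain ⟨z, hz, hd⟩ := h
    have h1 := ih hz
    have h2 := hC z
    have h3 := dist_triangle4 x z (F z) y
    push_cast
    linarith

/-- Rotation vectors of short loops. -/
def shortVecs (F : R2 → R2) (ε : ℝ) (M : ℕ) : Set R2 :=
  {v | ∃ k w, 1 ≤ k ∧ k ≤ M ∧ w ∈ intLattice ∧ (∃ x, Reach F ε k x (x + w)) ∧
    v = (k : ℝ)⁻¹ • w}

lemma finite_lattice_ball (R : ℝ) : {w : R2 | w ∈ intLattice ∧ ‖w‖ ≤ R}.Finite := by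
  refine ((Set.finite_Icc (fun _ : Fin 2 => -⌈R⌉) (fun _ => ⌈R⌉)).image zvec).subset ?_
  rintro w ⟨hw, hR⟩
  obtain ⟨m, rfl⟩ := exists_zvec hw
  refine ⟨m, ?_, rfl⟩
  have h : ∀ i, |(m i : ℝ)| ≤ ⌈R⌉ := fun i =>
    (PiLp.norm_apply_le (zvec m) i).trans (hR.trans (Int.le_ceil R))
  constructor <;> intro i
  · have := (abs_le.1 (h i)).1
    exact_mod_cast this
  · have := (abs_le.1 (h i)).2
    exact_mod_cast this

lemma shortVecs_finite {F : R2 → R2} (hF : Equi F) (hc : Continuous F) {ε : ℝ} (hε : 0 < ε)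
    (M : ℕ) : (shortVecs F ε M).Finite := by
  obtain ⟨C, hC0, hC⟩ := exists_disp_bound hF hc
  refine (((Set.finite_Icc 1 M).prod (finite_lattice_ball (M * (C + ε)))).image
    (fun p : ℕ × R2 => (p.1 : ℝ)⁻¹ • p.2)).subset ?_
  rintro _ ⟨k, w, h1, hM, hw, ⟨x, hx⟩, rfl⟩
  refine ⟨(k, w), ⟨⟨h1, hM⟩, hw, ?_⟩, rfl⟩
  have := hx.dist_le hC
  rw [dist_eq_norm, sub_add_cancel_left, norm_neg] at this
  refine this.trans ?_
  have : (k : ℝ) ≤ M := by exact_mod_cast hM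
  gcongr

lemma shortVecs_rational {F : R2 → R2} {ε : ℝ} {M : ℕ} {v : R2} (hv : v ∈ shortVecs F ε M) :
    IsRationalPoint v := by
  obtain ⟨k, w, -, -, hw, -, rfl⟩ := hv
  obtain ⟨m, rfl⟩ := exists_zvec hw
  intro i
  refine ⟨(k : ℚ)⁻¹ * m i, ?_⟩
  simp [zvec_apply]

lemma path_bound {F : R2 → R2} (hF : Equi F) (hc : Continuous F) {N : ℕ} (hN : 0 < N) {ε : ℝ}
    (hNε : 4 * (N : ℝ)⁻¹ < ε) (l : R2 →L[ℝ] ℝ) (u : ℝ)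
    (hl : ∀ v ∈ shortVecs F ε (N * N), l v ≤ u) :
    ∃ D, ∀ (n : ℕ) (s : ℕ → R2), (∀ i < n, cell N (F (s i)) = cell N (s (i + 1))) →
      l (corner N (s n) - corner N (s 0)) ≤ u * n + D := by
  obtain ⟨C, hC0, hC⟩ := exists_disp_bound hF hc
  have hε : 0 < ε := lt_of_le_of_lt (by positivity) hNε
  refine ⟨‖l‖ * (↑(N * N) * (C + ε) + ε + ε) + |u| * ↑(N * N), ?_⟩
  intro n
  induction n using Nat.strong_induction_on with
  | _ n ih =>
  intro s hs
  by_cases hn : N * N ≤ n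
  · obtain ⟨k, hk1, hkM, w, hw, hx, y, hy, he⟩ := excise hF hN hNε hn s hs
    have h1 := ih (n - k) (by omega) y hy
    have h2 := hl _ ⟨k, w, hk1, hkM, hw, hx, rfl⟩
    rw [map_smul, smul_eq_mul] at h2
    have hk : (0 : ℝ) < k := by exact_mod_cast hk1
    have h3 : l w ≤ u * k := by
      rw [inv_mul_le_iff₀ hk] at h2
      linarith
    rw [he, map_add]
    rw [Nat.cast_sub (hkM.trans hn)] at h1
    linarith
  · have hr : Reach F ε n (s 0) (s n) := Reach.of_seq s fun i hi =>
      (dist_of_cell hN (hs i hi)).trans_lt hNε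
    have h1 := hr.dist_le hC
    have hnM : (n : ℝ) ≤ ↑(N * N) := by
      have : n ≤ N * N := by omega
      exact_mod_cast this
    have h2 := corner_dist hN (s n)
    have h3 := corner_dist hN (s 0)
    have hpos : (0 : ℝ) ≤ (N : ℝ)⁻¹ := by positivity
    have h4 : ‖corner N (s n) - corner N (s 0)‖ ≤ ↑(N * N) * (C + ε) + ε + ε := by
      rw [← dist_eq_norm] at h2 h3 ⊢
      have h5 := dist_triangle4 (corner N (s n)) (s n) (s 0) (corner N (s 0))
      rw [dist_comm (s n) (s 0), dist_comm (s 0) (corner N (s 0))] at h5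
      have h6 : (n : ℝ) * (C + ε) ≤ ↑(N * N) * (C + ε) := by gcongr
      linarith
    have h5 : l (corner N (s n) - corner N (s 0)) ≤ ‖l‖ * (↑(N * N) * (C + ε) + ε + ε) :=
      (le_abs_self _).trans ((l.le_opNorm _).trans (by gcongr))
    have h6 : -(u * n) ≤ |u| * ↑(N * N) := by
      calc -(u * n) ≤ |u * n| := neg_le_abs _
        _ = |u| * n := by rw [abs_mul, Nat.abs_cast]
        _ ≤ _ := by gcongr
    linarith

lemma rotSet_subset {F : R2 ≃ₜ R2} (hF : Equi F) {N : ℕ} (hN : 0 < N) {ε : ℝ}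
    (hNε : 4 * (N : ℝ)⁻¹ < ε) :
    rotSet F ⊆ convexHull ℝ (shortVecs F ε (N * N)) := by
  have hε : 0 < ε := lt_of_le_of_lt (by positivity) hNε
  intro v hv
  by_contra hne
  have hfin := shortVecs_finite hF F.continuous hε (N * N)
  obtain ⟨l, u, hlu, huv⟩ := geometric_hahn_banach_closed_point (convex_convexHull ℝ _)
    (hfin.isCompact_convexHull ℝ).isClosed hne
  obtain ⟨D, hD⟩ := path_bound hF F.continuous hN hNε l u
    (fun v hv => (hlu v (subset_convexHull ℝ _ hv)).le)
  obtain ⟨z, n, hn, ht⟩ := hv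
  have t1 : Tendsto (fun k => l ((n k : ℝ)⁻¹ • ((⇑F)^[n k] (z k) - z k))) atTop (𝓝 (l v)) :=
    (l.continuous.tendsto v).comp ht
  have t2 : Tendsto (fun k => u + (n k : ℝ)⁻¹ * (D + ‖l‖ * (ε + ε))) atTop (𝓝 u) := by
    have h0 : Tendsto (fun k => (n k : ℝ)⁻¹) atTop (𝓝 0) :=
      tendsto_inv_atTop_zero.comp (tendsto_natCast_atTop_atTop.comp hn)
    have := (h0.mul_const (D + ‖l‖ * (ε + ε))).const_add u
    simpa using this
  have hle : l v ≤ u := by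
    refine le_of_tendsto_of_tendsto t1 t2 ?_
    filter_upwards [hn.eventually_ge_atTop 1] with k hk
    have hk0 : (0 : ℝ) < n k := by exact_mod_cast hk
    have h1 := hD (n k) (fun i => (⇑F)^[i] (z k)) (fun i _ => by
      rw [Function.iterate_succ_apply'])
    simp only [Function.iterate_zero, id] at h1
    have h2 := corner_dist hN ((⇑F)^[n k] (z k))
    have h3 := corner_dist hN (z k)
    have hpos : (0 : ℝ) ≤ (N : ℝ)⁻¹ := by positivity
    have h4 : l ((⇑F)^[n k] (z k) - z k) ≤ u * n k + (D + ‖l‖ * (ε + ε)) := by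
      have e : (⇑F)^[n k] (z k) - z k =
          (corner N ((⇑F)^[n k] (z k)) - corner N (z k)) +
          ((corner N (z k) - z k) - (corner N ((⇑F)^[n k] (z k)) - (⇑F)^[n k] (z k))) := by abel
      have h5 : l ((corner N (z k) - z k) -
          (corner N ((⇑F)^[n k] (z k)) - (⇑F)^[n k] (z k))) ≤ ‖l‖ * (ε + ε) := by
        refine (le_abs_self _).trans ((l.le_opNorm _).trans ?_)
        have := norm_sub_le (corner N (z k) - z k)
          (corner N ((⇑F)^[n k] (z k)) - (⇑F)^[n k] (z k))
        gcongr
        linarith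
      rw [e, map_add]
      linarith
    rw [map_smul, smul_eq_mul, inv_mul_le_iff₀ hk0, mul_add, ← mul_assoc,
      mul_inv_cancel₀ hk0.ne', one_mul]
    linarith
  linarith

/-! ### Conclusion -/

lemma main_of_stable {f : T2 ≃ₜ T2} (hf : f ∈ Homeo0Leb) {F : R2 ≃ₜ R2} (hF : IsLift f F)
    {δ : ℝ} (hδ : 0 < δ) (hst : StableRS Homeo0Leb F δ) :
    (∃ V : Finset R2, (∀ v ∈ V, IsRationalPoint v) ∧
        rotSet F = convexHull ℝ (V : Set R2)) ∧
      (interior (rotSet F)).Nonempty := by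
  have hE : Equi F := hF.equivariant
  have hε : 0 < δ / 4 := by positivity
  have hεδ : 2 * (δ / 4) < δ := by linarith
  set ε := δ / 4
  obtain ⟨N, hN⟩ := exists_nat_gt (4 / ε)
  have hN0 : (0 : ℝ) < N := lt_trans (by positivity) hN
  have hNpos : 0 < N := by exact_mod_cast hN0
  have hNε : 4 * (N : ℝ)⁻¹ < ε := by
    rw [div_lt_iff₀ hε] at hN
    rw [← div_eq_mul_inv, div_lt_iff₀ hN0]
    linarith
  have hfin := shortVecs_finite hE F.continuous hε (N * N)
  have hret : retVecs F ε ⊆ rotSet F := by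
    rintro _ ⟨n, w, hnw, rfl⟩
    exact loop_mem_rotSet hf hF hst hε hεδ hnw.1 hnw.2.1 (x := 0) (by
      rw [zero_add]; exact hnw.2.2)
  have heq : rotSet F = convexHull ℝ (shortVecs F ε (N * N)) := by
    refine Set.Subset.antisymm (rotSet_subset hE hNpos hNε) ?_
    refine (convexHull_min ?_ (convex_closure_retVecs hE)).trans
      (closure_minimal hret (isClosed_rotSet F))
    rintro _ ⟨k, w, hk, -, hw, ⟨x, hx⟩, rfl⟩
    exact loop_mem_closure hf hF hε hk hw hx
  refine ⟨⟨hfin.toFinset, fun v hv => shortVecs_rational (hfin.mem_toFinset.1 hv), ?_⟩, ?_⟩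
  · rw [hfin.coe_toFinset]; exact heq
  · refine interior_nonempty_of hf hF hε ?_ hret
    rw [heq]; exact convex_convexHull ℝ _

lemma rotSet_shift {F F' : R2 ≃ₜ R2} (hF : Equi F) {w : R2} (hw : w ∈ intLattice)
    (h : ∀ x, F' x = F x + w) {v : R2} (hv : v ∈ rotSet F) : v + w ∈ rotSet F' := by
  have hit : ∀ (n : ℕ) (x : R2), (⇑F')^[n] x = (⇑F)^[n] x + (n : ℝ) • w := by
    intro n x
    induction n with
    | zero => simp
    | succ n ih =>
      rw [Function.iterate_succ_apply', ih, h, hF _ _ (nsmul_mem_lat hw n),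
        Function.iterate_succ_apply']
      push_cast
      module
  obtain ⟨z, n, hn, ht⟩ := hv
  refine ⟨z, n, hn, (ht.add_const w).congr' ?_⟩
  filter_upwards [hn.eventually_ge_atTop 1] with k hk
  have hk0 : (n k : ℝ) ≠ 0 := by
    have : (0 : ℝ) < n k := by exact_mod_cast hk
    exact this.ne'
  rw [hit, add_sub_right_comm, smul_add, smul_smul, inv_mul_cancel₀ hk0, one_smul]

lemma rotSet_shift_iff {F F' : R2 ≃ₜ R2} (hF : Equi F) (hF' : Equi F') {w : R2}
    (hw : w ∈ intLattice) (h : ∀ x, F' x = F x + w) {v : R2} :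
    v ∈ rotSet F' ↔ v - w ∈ rotSet F := by
  constructor
  · intro hv
    have := rotSet_shift hF' (F' := F) (intLattice.neg_mem hw) (fun x => by rw [h]; abel) hv
    rwa [← sub_eq_add_neg] at this
  · intro hv
    have := rotSet_shift hF hw h hv
    rwa [sub_add_cancel] at this

lemma lift_unique {f : T2 ≃ₜ T2} {F F' : R2 ≃ₜ R2} (hF : IsLift f F) (hF' : IsLift f F') :
    ∃ w ∈ intLattice, ∀ x, F' x = F x + w := by
  have h : ∀ x, ∃ m, F' x = F x + zvec m := by
    intro x
    obtain ⟨w, hw, he⟩ := (pr_eq_iff (F x) (F' x)).1 (by rw [hF.proj, hF'.proj])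
    obtain ⟨m, rfl⟩ := exists_zvec hw
    exact ⟨m, he⟩
  choose m hm using h
  have hc : ∀ i, Continuous (fun x => m x i) := by
    intro i
    rw [Int.isClosedEmbedding_coe_real.isInducing.continuous_iff]
    have : (((↑) : ℤ → ℝ) ∘ fun x => m x i) = fun x => F' x i - F x i := by
      funext x
      rw [hm x]
      simp [zvec_apply]
    rw [this]
    fun_prop
  refine ⟨zvec (m 0), zvec_mem _, fun x => ?_⟩
  have : m x = m 0 := by
    funext i
    exact PreconnectedSpace.constant inferInstance (hc i)
  rw [hm x, this]

lemma stable_shift {f : T2 ≃ₜ T2} {F F' : R2 ≃ₜ R2} (hF : IsLift f F) (hF' : IsLift f F')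
    {δ : ℝ} (hst : StableRS Homeo0Leb F δ) : StableRS Homeo0Leb F' δ := by
  obtain ⟨w, hw, h⟩ := lift_unique hF hF'
  intro g hg G' hG' hd
  let G : R2 ≃ₜ R2 := G'.trans (Homeomorph.addRight (-w))
  have hGx : ∀ x, G' x = G x + w := fun x => by
    change G' x = G' x + -w + w
    abel
  have hGx' : ∀ x, G x = G' x + -w := fun x => rfl
  have hG : IsLift g G := by
    refine ⟨fun x => ?_, fun x u hu => ?_⟩
    · rw [hGx', pr_add _ _ (intLattice.neg_mem hw), hG'.proj]
    · rw [hGx', hGx', hG'.equivariant x u hu]; abel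
  have hd' : supDist F G = supDist F' G' := by
    unfold supDist
    congr 1
    funext x
    rw [h, hGx, dist_add_right]
  have he := hst g hg G hG (by rw [hd']; exact hd)
  ext v
  rw [rotSet_shift_iff hG.equivariant hG'.equivariant hw hGx, he,
    rotSet_shift_iff hF.equivariant hF'.equivariant hw h]


/-- If `f ∈ Homeo_{0,λ}(T²)` has a stable rotation set (in the
area-preserving setting), then for any lift `F` of `f`, the rotation set `ρ(F)` is the
convex hull of a finite subset of `ℚ²` and has nonempty interior in `ℝ²`. -/
theorem rotSet_polygon_nonempty_interior_of_stable_leb (f : T2 ≃ₜ T2)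
    (hf : f ∈ Homeo0Leb) (hstable : HasStableRotSet Homeo0Leb f) :
    ∀ F : R2 ≃ₜ R2, IsLift f F →
      (∃ V : Finset R2, (∀ v ∈ V, IsRationalPoint v) ∧
        rotSet F = convexHull ℝ (V : Set R2)) ∧
      (interior (rotSet F)).Nonempty := by
  intro F hF
  obtain ⟨F0, hF0, δ, hδ, hst⟩ := hstable
  exact main_of_stable hf hF hδ (stable_shift hF0 hF hst)
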